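/- Let f be an nc self-map of 𝔅_d with f₁(0) = 0, and suppose there exists a generic point X ∈ 𝔅_d(n) with f_n(X) = X. Then for every m ≥ 1 and every Z ∈ 𝔅_d(m) with L_X ⊆ L_Z (the coordinates of Z satisfy every homogeneous linear relation satisfied by the coordinates of X), one has f_m(Z) = Z. -/

import Mathlib

open Matrix
open scoped ComplexOrder

attribute [local instance] Matrix.normedAddCommGroup Matrix.normedSpace

/-- The space of `d`-tuples of `n × n` complex matrices. -/
abbrev MatTuple (d n : ℕ) := Fin d → Matrix (Fin n) (Fin n) ℂ

/-- The free matrix ball at level `n`: strict row contractions. -/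
def freeBall (d n : ℕ) : Set (MatTuple d n) :=
  {X | (1 - ∑ j, X j * (X j)ᴴ).PosDef}

/-- The direct sum of two tuples of matrices. -/
def dSum {d n m : ℕ} (X : MatTuple d n) (Y : MatTuple d m) : MatTuple d (n + m) :=
  fun j => Matrix.reindex finSumFinEquiv finSumFinEquiv (Matrix.fromBlocks (X j) 0 0 (Y j))

/-- An nc self-map of the free ball `𝔅_d`. -/
structure NCSelfMap (d : ℕ) where
  app : ∀ n, MatTuple d n → MatTuple d n
  mapsTo : ∀ n, Set.MapsTo (app n) (freeBall d n) (freeBall d n)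
  map_dSum : ∀ {n m : ℕ} (X : MatTuple d n) (Y : MatTuple d m),
    X ∈ freeBall d n → Y ∈ freeBall d m →
    app (n + m) (dSum X Y) = dSum (app n X) (app m Y)
  map_sim : ∀ {n : ℕ} (X : MatTuple d n) (S : Matrix (Fin n) (Fin n) ℂ),
    X ∈ freeBall d n → IsUnit S →
    (fun j => S⁻¹ * X j * S) ∈ freeBall d n →
    app n (fun j => S⁻¹ * X j * S) = fun j => S⁻¹ * app n X j * S
  holo : ∀ n, DifferentiableOn ℂ (app n) (freeBall d n)

/-- A tuple is generic if its coordinates generate the full matrix algebra. -/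
def IsGeneric {d n : ℕ} (X : MatTuple d n) : Prop :=
  Algebra.adjoin ℂ (Set.range X) = ⊤

/-- The homogeneous degree-one linear relations satisfied by the coordinates of `X`. -/
def linRel {d n : ℕ} (X : MatTuple d n) : Set (Fin d → ℂ) :=
  {α | ∑ j, α j • X j = 0}

/-- The scalar point of level `n` associated to a vector in `ℂ^d`. -/
def scalarPt (d n : ℕ) (v : Fin d → ℂ) : MatTuple d n :=
  fun j => v j • (1 : Matrix (Fin n) (Fin n) ℂ)

open scoped Topology

/-- The Gram matrix `∑ j, X j * (X j)ᴴ` of a tuple. -/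
def rowGram {d n : ℕ} (X : MatTuple d n) : Matrix (Fin n) (Fin n) ℂ :=
  ∑ j, X j * (X j)ᴴ

lemma rowGram_isHermitian {d n : ℕ} (X : MatTuple d n) : (rowGram X).IsHermitian := by
  simp [rowGram, Matrix.IsHermitian, Matrix.conjTranspose_sum]

lemma rowGram_left_mul {d n : ℕ} (G : Matrix (Fin n) (Fin n) ℂ) (X : MatTuple d n) :
    rowGram (fun j => G * X j) = G * rowGram X * Gᴴ := by
  simp only [rowGram, Matrix.conjTranspose_mul, Finset.mul_sum, Finset.sum_mul, Matrix.mul_assoc]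

lemma rowGram_smul {d n : ℕ} (c : ℂ) (X : MatTuple d n) :
    rowGram (c • X) = (c * star c) • rowGram X := by
  simp [rowGram, Matrix.conjTranspose_smul, smul_smul, Finset.smul_sum, mul_comm]

lemma continuous_rowGram (d n : ℕ) : Continuous (rowGram : MatTuple d n → _) := by
  unfold rowGram
  fun_prop

/-- Positive definiteness is an open condition among Hermitian matrices. -/
lemma eventually_posDef {α : Type*} [TopologicalSpace α] {n : ℕ}
    {M : α → Matrix (Fin n) (Fin n) ℂ} (hM : Continuous M) (hH : ∀ a, (M a).IsHermitian) {a₀ : α}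
    (h : (M a₀).PosDef) : ∀ᶠ a in 𝓝 a₀, (M a).PosDef := by
  have hev : ∀ᶠ a in 𝓝 a₀, ∀ v ∈ Metric.sphere (0 : Fin n → ℂ) 1,
      0 < (star v ⬝ᵥ M a *ᵥ v).re := by
    refine (isCompact_sphere (0 : Fin n → ℂ) 1).eventually_forall_of_forall_eventually
      fun v hv => ?_
    have hc : Continuous fun p : α × (Fin n → ℂ) => (star p.2 ⬝ᵥ M p.1 *ᵥ p.2).re := by
      fun_prop
    exact hc.continuousAt.eventually
      (lt_mem_nhds (h.re_dotProduct_pos (ne_zero_of_mem_unit_sphere ⟨v, hv⟩)))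
  filter_upwards [hev] with a ha
  refine .of_dotProduct_mulVec_pos (hH a) fun v hv => ?_
  rw [Complex.pos_iff]
  refine ⟨?_, ((hH a).im_star_dotProduct_mulVec_self v).symm⟩
  have hv' : ‖v‖ ≠ 0 := norm_ne_zero_iff.mpr hv
  have := ha ((‖v‖⁻¹ : ℂ) • v) (by simp [norm_smul, hv'])
  rw [star_smul, Matrix.mulVec_smul, smul_dotProduct, dotProduct_smul, smul_smul,
    show star (‖v‖⁻¹ : ℂ) * (‖v‖⁻¹ : ℂ) = ((‖v‖⁻¹ * ‖v‖⁻¹ : ℝ) : ℂ) by simp,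
    smul_eq_mul, Complex.re_ofReal_mul] at this
  exact pos_of_mul_pos_right this (by positivity)

lemma isOpen_freeBall (d n : ℕ) : IsOpen (freeBall d n) :=
  isOpen_iff_eventually.mpr fun _ hX =>
    eventually_posDef (continuous_const.sub (continuous_rowGram d n))
      (fun X => Matrix.isHermitian_one.sub (rowGram_isHermitian X)) hX

lemma mem_freeBall_of_rowGram_eq {d n : ℕ} {X : MatTuple d n} {c : ℝ} (hc : c < 1)
    (h : rowGram X = (c : ℂ) • 1) : X ∈ freeBall d n := by
  change (1 - rowGram X).PosDef
  have : 1 - rowGram X = ((1 - c : ℝ) : ℂ) • (1 : Matrix (Fin n) (Fin n) ℂ) := by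
    rw [h, Complex.ofReal_sub, sub_smul, Complex.ofReal_one, one_smul]
  rw [this]
  exact Matrix.PosDef.one.smul (by rw [Complex.pos_iff]; simp [hc])

lemma zero_mem_freeBall (d n : ℕ) : (0 : MatTuple d n) ∈ freeBall d n :=
  mem_freeBall_of_rowGram_eq zero_lt_one (by simp [rowGram])

lemma rowGram_dSum {d n m : ℕ} (X : MatTuple d n) (Y : MatTuple d m) :
    rowGram (dSum X Y) = Matrix.reindex finSumFinEquiv finSumFinEquiv
      (Matrix.fromBlocks (rowGram X) 0 0 (rowGram Y)) := by
  have : Matrix.fromBlocks (rowGram X) 0 0 (rowGram Y) =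
      ∑ j, Matrix.fromBlocks (X j * (X j)ᴴ) 0 0 (Y j * (Y j)ᴴ) := by
    ext a b
    rcases a with a | a <;> rcases b with b | b <;> simp [rowGram, Matrix.sum_apply]
  rw [this]
  ext a b
  simp [rowGram, dSum, Matrix.sum_apply, Matrix.conjTranspose_submatrix,
    Matrix.fromBlocks_conjTranspose, Matrix.submatrix_mul_equiv, Matrix.fromBlocks_multiply]

lemma dSum_mem_freeBall {d n m : ℕ} {X : MatTuple d n} {Y : MatTuple d m}
    (hX : X ∈ freeBall d n) (hY : Y ∈ freeBall d m) : dSum X Y ∈ freeBall d (n + m) := by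
  change (1 - rowGram (dSum X Y)).PosDef
  have hX' : (1 - rowGram X).PosDef := hX
  have hY' : (1 - rowGram Y).PosDef := hY
  have h1 : 1 - rowGram (dSum X Y) = (Matrix.fromBlocks (1 - rowGram X) 0 0
      (1 - rowGram Y)).submatrix finSumFinEquiv.symm finSumFinEquiv.symm := by
    rw [rowGram_dSum]
    have : (1 : Matrix (Fin (n + m)) (Fin (n + m)) ℂ) =
        (Matrix.fromBlocks 1 0 0 1 : Matrix (Fin n ⊕ Fin m) (Fin n ⊕ Fin m) ℂ).submatrix
          finSumFinEquiv.symm finSumFinEquiv.symm := by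
      simp [Matrix.fromBlocks_one]
    rw [this, Matrix.reindex_apply]
    ext a b
    simp only [Matrix.sub_apply, Matrix.submatrix_apply]
    rcases finSumFinEquiv.symm a with a | a <;> rcases finSumFinEquiv.symm b with b | b <;> simp
  rw [h1]
  refine Matrix.PosDef.submatrix ?_ finSumFinEquiv.symm.injective
  refine .of_dotProduct_mulVec_pos
    (Matrix.IsHermitian.fromBlocks hX'.isHermitian (by simp) hY'.isHermitian) fun v hv => ?_
  obtain ⟨x, y, rfl⟩ : ∃ x y, v = Sum.elim x y := ⟨v ∘ Sum.inl, v ∘ Sum.inr, by simp⟩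
  have hs : star (Sum.elim x y) = Sum.elim (star x) (star y) := by
    ext i; rcases i with i | i <;> rfl
  rw [Matrix.fromBlocks_mulVec, hs, sumElim_dotProduct_sumElim]
  simp only [Sum.elim_comp_inl, Sum.elim_comp_inr, Matrix.zero_mulVec, add_zero, zero_add]
  by_cases hx : x = 0
  · have hy : y ≠ 0 := by
      rintro rfl; subst hx
      exact hv (by ext i; rcases i with i | i <;> rfl)
    exact add_pos_of_nonneg_of_pos (hX'.posSemidef.dotProduct_mulVec_nonneg x)
      (hY'.dotProduct_mulVec_pos hy)
  · exact add_pos_of_pos_of_nonneg (hX'.dotProduct_mulVec_pos hx)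
      (hY'.posSemidef.dotProduct_mulVec_nonneg y)

namespace NCSelfMap

/-- nc maps respect intertwiners. -/
lemma intertwine {d n m : ℕ} (f : NCSelfMap d) {X : MatTuple d n} {Y : MatTuple d m}
    (hX : X ∈ freeBall d n) (hY : Y ∈ freeBall d m) (T : Matrix (Fin n) (Fin m) ℂ)
    (h : ∀ j, X j * T = T * Y j) (j : Fin d) : f.app n X j * T = T * f.app m Y j := by
  set e := (finSumFinEquiv : Fin n ⊕ Fin m ≃ Fin (n + m))
  set S₀ : Matrix (Fin n ⊕ Fin m) (Fin n ⊕ Fin m) ℂ := Matrix.fromBlocks 1 T 0 1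
  set S : Matrix (Fin (n + m)) (Fin (n + m)) ℂ := Matrix.reindex e e S₀
  set R : Matrix (Fin (n + m)) (Fin (n + m)) ℂ := Matrix.reindex e e (Matrix.fromBlocks 1 (-T) 0 1)
  have hSR : S * R = 1 := by
    simp [S, R, S₀, Matrix.submatrix_mul_equiv, Matrix.fromBlocks_multiply]
  have hunit : IsUnit S := IsUnit.of_mul_eq_one _ hSR
  have hmul : ∀ (A : Matrix (Fin n) (Fin n) ℂ) (B : Matrix (Fin m) (Fin m) ℂ),
      Matrix.reindex e e (Matrix.fromBlocks A 0 0 B) * S =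
        Matrix.reindex e e (Matrix.fromBlocks A (A * T) 0 B) := fun A B => by
    simp [S, S₀, Matrix.submatrix_mul_equiv, Matrix.fromBlocks_multiply]
  have hmul' : ∀ (A : Matrix (Fin n) (Fin n) ℂ) (B : Matrix (Fin m) (Fin m) ℂ),
      S * Matrix.reindex e e (Matrix.fromBlocks A 0 0 B) =
        Matrix.reindex e e (Matrix.fromBlocks A (T * B) 0 B) := fun A B => by
    simp [S, S₀, Matrix.submatrix_mul_equiv, Matrix.fromBlocks_multiply]
  have hdet : IsUnit S.det := (Matrix.isUnit_iff_isUnit_det S).mp hunit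
  have hcomm : (fun j => S⁻¹ * dSum X Y j * S) = dSum X Y := by
    funext i
    rw [Matrix.mul_assoc, dSum, hmul, h i, ← hmul', Matrix.nonsing_inv_mul_cancel_left _ _ hdet]
  have hmem := dSum_mem_freeBall hX hY
  have hsim := congrFun (f.map_sim (dSum X Y) S hmem hunit (by rw [hcomm]; exact hmem)) j
  rw [hcomm, f.map_dSum X Y hX hY] at hsim
  have h2 : S * dSum (f.app n X) (f.app m Y) j = dSum (f.app n X) (f.app m Y) j * S := by
    conv_lhs => rw [hsim]
    rw [Matrix.mul_assoc, Matrix.mul_nonsing_inv_cancel_left _ _ hdet]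
  rw [dSum, hmul, hmul'] at h2
  have h3 := (Matrix.reindex e e).injective h2
  rw [Matrix.fromBlocks_inj] at h3
  exact h3.2.1.symm

lemma app_zero {d : ℕ} (f : NCSelfMap d) (hf0 : f.app 1 0 = 0) (n : ℕ) : f.app n 0 = 0 := by
  funext j
  ext a b
  have := f.intertwine (zero_mem_freeBall d n) (zero_mem_freeBall d 1)
    (Matrix.replicateCol (Fin 1) (Pi.single b 1)) (by simp) j
  rw [hf0] at this
  simpa [Matrix.mul_apply, Pi.single_apply] using congrFun (congrFun this a) 0

lemma hasFDerivAt_zero {d : ℕ} (f : NCSelfMap d) (n : ℕ) :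
    HasFDerivAt (f.app n) (fderiv ℂ (f.app n) 0) 0 :=
  ((f.holo n).differentiableAt
    ((isOpen_freeBall d n).mem_nhds (zero_mem_freeBall d n))).hasFDerivAt

lemma hasDerivAt_smul {d n : ℕ} (f : NCSelfMap d) (X : MatTuple d n) :
    HasDerivAt (fun t : ℂ => f.app n (t • X)) (fderiv ℂ (f.app n) 0 X) 0 := by
  have h1 : HasDerivAt (fun t : ℂ => t • X) X 0 := by
    have := (hasDerivAt_id (0 : ℂ)).smul_const X
    rw [one_smul] at this
    exact this
  have h2 : HasFDerivAt (f.app n) (fderiv ℂ (f.app n) 0) ((0 : ℂ) • X) := by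
    simpa using f.hasFDerivAt_zero n
  exact h2.comp_hasDerivAt (0 : ℂ) h1

lemma eventually_smul_mem {d n : ℕ} (X : MatTuple d n) :
    ∀ᶠ t : ℂ in 𝓝 0, t • X ∈ freeBall d n := by
  have h1 : Continuous fun t : ℂ => t • X := by fun_prop
  exact h1.continuousAt.eventually_mem
    (by simpa using (isOpen_freeBall d n).mem_nhds (zero_mem_freeBall d n))

lemma fderiv_intertwine {d n m : ℕ} (f : NCSelfMap d) (X : MatTuple d n) (Y : MatTuple d m)
    (T : Matrix (Fin n) (Fin m) ℂ) (h : ∀ j, X j * T = T * Y j) (j : Fin d) :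
    fderiv ℂ (f.app n) 0 X j * T = T * fderiv ℂ (f.app m) 0 Y j := by
  let LX : MatTuple d n →L[ℂ] Matrix (Fin n) (Fin m) ℂ := LinearMap.toContinuousLinearMap
    { toFun := fun W => W j * T
      map_add' := fun _ _ => by simp [Matrix.add_mul]
      map_smul' := fun _ _ => by simp }
  let LY : MatTuple d m →L[ℂ] Matrix (Fin n) (Fin m) ℂ := LinearMap.toContinuousLinearMap
    { toFun := fun W => T * W j
      map_add' := fun _ _ => by simp [Matrix.mul_add]
      map_smul' := fun _ _ => by simp }
  have h1 := LX.hasFDerivAt.comp_hasDerivAt (0 : ℂ) (f.hasDerivAt_smul X)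
  have h2 := LY.hasFDerivAt.comp_hasDerivAt (0 : ℂ) (f.hasDerivAt_smul Y)
  refine h1.unique (h2.congr_of_eventuallyEq ?_)
  filter_upwards [eventually_smul_mem X, eventually_smul_mem Y] with t hX hY
  exact f.intertwine hX hY T (fun i => by simp [h i]) j

lemma fderiv_rankOne {d n : ℕ} (f : NCSelfMap d) (v : Fin d → ℂ) (u w : Fin n → ℂ)
    (huw : w ⬝ᵥ u = 1) (i : Fin d) :
    fderiv ℂ (f.app n) 0 (fun j => v j • Matrix.vecMulVec u w) i =
      fderiv ℂ (f.app 1) 0 (scalarPt d 1 v) i 0 0 • Matrix.vecMulVec u w := by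
  set D := fderiv ℂ (f.app n) 0 (fun j => v j • Matrix.vecMulVec u w) i with hD
  set a := fderiv ℂ (f.app 1) 0 (scalarPt d 1 v) i
  have hE : Matrix.vecMulVec u w * Matrix.vecMulVec u w = Matrix.vecMulVec u w := by
    rw [Matrix.vecMulVec_mul_vecMulVec, huw, one_smul]
  have h1 : D * Matrix.replicateCol (Fin 1) u = Matrix.replicateCol (Fin 1) u * a :=
    f.fderiv_intertwine _ _ _ (fun j => by
      rw [scalarPt, Matrix.smul_mul, Matrix.mul_smul, Matrix.mul_one,
        Matrix.vecMulVec_eq (Fin 1), Matrix.mul_assoc]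
      congr 1
      ext x y
      simpa [Matrix.mul_apply, dotProduct, Finset.mul_sum, mul_comm, mul_left_comm] using
        congrArg (u x * ·) huw) i
  have h2 : D * (1 - Matrix.vecMulVec u w) = 0 := by
    rw [hD, f.fderiv_intertwine (fun j => v j • Matrix.vecMulVec u w) (0 : MatTuple d n) _
      (fun j => by simp [mul_sub, hE]) i]
    simp
  have h3 : a = a 0 0 • 1 := by
    ext x y
    simp [Subsingleton.elim x 0, Subsingleton.elim y 0]
  rw [mul_sub, mul_one, sub_eq_zero] at h2
  rw [h2, Matrix.vecMulVec_eq (Fin 1), ← Matrix.mul_assoc, h1, h3]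
  simp

lemma fderiv_smul_single {d n : ℕ} (f : NCSelfMap d) (v : Fin d → ℂ) (a b : Fin n) (i : Fin d) :
    fderiv ℂ (f.app n) 0 (fun j => v j • Matrix.single a b (1 : ℂ)) i =
      fderiv ℂ (f.app 1) 0 (scalarPt d 1 v) i 0 0 • Matrix.single a b (1 : ℂ) := by
  rw [Matrix.single_eq_single_vecMulVec_single]
  by_cases hab : a = b
  · subst hab
    exact f.fderiv_rankOne v _ _ (by simp) i
  · have h : Matrix.vecMulVec (Pi.single a 1) (Pi.single b (1 : ℂ)) =
        Matrix.vecMulVec (Pi.single a 1) (Pi.single a (1 : ℂ) + Pi.single b 1) -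
          Matrix.vecMulVec (Pi.single a 1) (Pi.single a 1) := by
      rw [Matrix.vecMulVec_add, add_sub_cancel_left]
    rw [h, smul_sub, ← f.fderiv_rankOne v _ _ (by simp [Ne.symm hab]) i,
      ← f.fderiv_rankOne v _ _ (by simp) i, ← Pi.sub_apply, ← map_sub]
    simp only [smul_sub]
    rfl

/-- The derivative at the origin acts by the same scalar matrix on all levels. -/
lemma fderiv_eq_sum {d n : ℕ} (f : NCSelfMap d) (Z : MatTuple d n) (i : Fin d) :
    fderiv ℂ (f.app n) 0 Z i =
      ∑ j, fderiv ℂ (f.app 1) 0 (scalarPt d 1 (Pi.single j 1)) i 0 0 • Z j := by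
  have hZ : Z = ∑ j, ∑ a, ∑ b, Z j a b •
      (fun k => (Pi.single j (1 : ℂ) : Fin d → ℂ) k • Matrix.single a b (1 : ℂ)) := by
    funext k
    simp only [Finset.sum_apply, Pi.smul_apply, smul_smul]
    rw [Finset.sum_eq_single k]
    · conv_lhs => rw [Matrix.matrix_eq_sum_single (Z k)]
      simp
    · intro j _ hj
      simp [Ne.symm hj]
    · simp
  conv_lhs => rw [hZ]
  simp only [map_sum, map_smul, Finset.sum_apply, Pi.smul_apply]
  refine Finset.sum_congr rfl fun j _ => ?_
  conv_rhs => rw [Matrix.matrix_eq_sum_single (Z j)]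
  simp only [Finset.smul_sum]
  refine Finset.sum_congr rfl fun a _ => Finset.sum_congr rfl fun b _ => ?_
  rw [f.fderiv_smul_single, smul_comm, Matrix.smul_single, smul_eq_mul, mul_one]

lemma fderiv_eq_self_of_linRel {d n m : ℕ} (f : NCSelfMap d) {Y : MatTuple d n}
    {W : MatTuple d m} (hY : fderiv ℂ (f.app n) 0 Y = Y) (hYW : linRel Y ⊆ linRel W) :
    fderiv ℂ (f.app m) 0 W = W := by
  funext i
  set c : Fin d → ℂ := fun j => fderiv ℂ (f.app 1) 0 (scalarPt d 1 (Pi.single j 1)) i 0 0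
  have key : ∀ {k : ℕ} (V : MatTuple d k),
      ∑ j, (c - Pi.single i (1 : ℂ) : Fin d → ℂ) j • V j =
        fderiv ℂ (f.app k) 0 V i - V i := fun V => by
    rw [f.fderiv_eq_sum]
    simp [c, sub_smul, Finset.sum_sub_distrib, Pi.single_apply, ite_smul]
  have h1 : (c - Pi.single i (1 : ℂ) : Fin d → ℂ) ∈ linRel Y := by
    change ∑ j, _ = _
    rw [key, hY, sub_self]
  have h2 : ∑ j, (c - Pi.single i (1 : ℂ) : Fin d → ℂ) j • W j = 0 := hYW h1
  rwa [key, sub_eq_zero] at h2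

end NCSelfMap

/-- A tuple of matrices as a vector of the Hilbert space of its entries. -/
noncomputable def toHS (d n : ℕ) :
    MatTuple d n →L[ℂ] EuclideanSpace ℂ (Fin d × Fin n × Fin n) :=
  LinearMap.toContinuousLinearMap
    { toFun := fun X => WithLp.toLp 2 fun p => X p.1 p.2.1 p.2.2
      map_add' := fun _ _ => rfl
      map_smul' := fun _ _ => rfl }

lemma toHS_injective (d n : ℕ) : Function.Injective (toHS d n) := fun X Y h => by
  funext j
  ext a b
  exact congrFun (congrArg WithLp.ofLp h) (j, a, b)

lemma norm_toHS_sq {d n : ℕ} (X : MatTuple d n) :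
    ‖toHS d n X‖ ^ 2 = (rowGram X).trace.re := by
  rw [EuclideanSpace.norm_sq_eq]
  simp only [rowGram, Matrix.trace_sum, Complex.re_sum, Fintype.sum_prod_type]
  simp only [Matrix.trace, Matrix.diag_apply, Matrix.mul_apply, Matrix.conjTranspose_apply,
    Complex.re_sum]
  refine Finset.sum_congr rfl fun j _ => Finset.sum_congr rfl fun a _ =>
    Finset.sum_congr rfl fun b _ => ?_
  rw [Complex.star_def, Complex.mul_conj, Complex.ofReal_re, Complex.normSq_eq_norm_sq]
  rfl

lemma norm_toHS_le {d n : ℕ} {X : MatTuple d n} (hX : X ∈ freeBall d n) :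
    ‖toHS d n X‖ ≤ √n := by
  apply Real.le_sqrt_of_sq_le
  have h : 0 ≤ (1 - rowGram X).trace := (Matrix.PosDef.posSemidef hX).trace_nonneg
  have h' := (Complex.le_def.mp h).1
  rw [norm_toHS_sq]
  simpa [Matrix.trace_sub] using h'

lemma smul_mem_freeBall {d n : ℕ} {W : MatTuple d n} (hW : rowGram W = 1) {t : ℂ}
    (ht : ‖t‖ < 1) : t • W ∈ freeBall d n := by
  refine mem_freeBall_of_rowGram_eq (c := ‖t‖ ^ 2) (by nlinarith [norm_nonneg t]) ?_
  rw [rowGram_smul, hW, Complex.star_def, Complex.mul_conj, Complex.normSq_eq_norm_sq]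

namespace NCSelfMap

/-- Rigidity in the Schwarz lemma along the disc spanned by a row coisometry. -/
lemma app_smul_of_dslope {d m : ℕ} (f : NCSelfMap d) (hf0 : f.app 1 0 = 0) {W : MatTuple d m}
    (hW : rowGram W = 1) {z : ℂ} (hz : ‖z‖ < 1)
    (h : dslope (fun t : ℂ => f.app m (t • W)) 0 z = W) {t : ℂ} (ht : ‖t‖ < 1) :
    f.app m (t • W) = t • W := by
  have hmaps : Set.MapsTo (fun t : ℂ => t • W) (Metric.ball 0 1) (freeBall d m) := fun t ht =>
    smul_mem_freeBall hW (mem_ball_zero_iff.mp ht)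
  have hd : DifferentiableOn ℂ (fun t : ℂ => f.app m (t • W)) (Metric.ball 0 1) :=
    (f.holo m).comp (differentiable_id.smul_const W).differentiableOn hmaps
  set g : ℂ → EuclideanSpace ℂ (Fin d × Fin m × Fin m) := toHS d m ∘ fun t : ℂ => f.app m (t • W)
  have hg0 : g 0 = 0 := by simp [g, f.app_zero hf0]
  have hgd : DifferentiableOn ℂ g (Metric.ball 0 1) :=
    (toHS d m).differentiable.comp_differentiableOn hd
  have hgm : Set.MapsTo g (Metric.ball 0 1) (Metric.closedBall (g 0) √m) := fun t ht => by
    rw [hg0, mem_closedBall_zero_iff]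
    exact norm_toHS_le (f.mapsTo m (hmaps ht))
  have hgs : dslope g 0 z = toHS d m W := by
    rw [← h]
    exact ContinuousLinearMap.dslope_comp _ _ _ _ fun _ =>
      hd.differentiableAt (Metric.ball_mem_nhds _ one_pos)
  have hnorm : ‖toHS d m W‖ = √m := by
    rw [← Real.sqrt_sq (norm_nonneg (toHS d m W)), norm_toHS_sq, hW]
    simp
  have := Complex.affine_of_mapsTo_ball_of_norm_dslope_eq_div hgd hgm (mem_ball_zero_iff.mpr hz)
    (by rw [hgs, hnorm, div_one]) (mem_ball_zero_iff.mpr ht)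
  apply toHS_injective
  rw [map_smul, ← hgs]
  simpa [hg0] using! this

/-- If `r • W` is fixed, `W` a row coisometry, `0 < r < 1`, then the derivative fixes `W`. -/
lemma fderiv_of_app_smul {d m : ℕ} (f : NCSelfMap d) (hf0 : f.app 1 0 = 0) {W : MatTuple d m}
    (hW : rowGram W = 1) {z : ℂ} (hz : ‖z‖ < 1) (hz0 : z ≠ 0) (h : f.app m (z • W) = z • W) :
    fderiv ℂ (f.app m) 0 W = W := by
  have h1 : dslope (fun t : ℂ => f.app m (t • W)) 0 z = W := by
    rw [dslope_of_ne _ hz0, slope_def_module]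
    simp [h, f.app_zero hf0, smul_smul, hz0]
  have h2 : HasDerivAt (fun t : ℂ => t • W) W 0 := by
    have := (hasDerivAt_id (0 : ℂ)).smul_const W
    rw [one_smul] at this
    exact this
  refine (f.hasDerivAt_smul W).unique (h2.congr_of_eventuallyEq ?_)
  filter_upwards [Metric.ball_mem_nhds (0 : ℂ) one_pos] with t ht
  exact f.app_smul_of_dslope hf0 hW hz h1 (mem_ball_zero_iff.mp ht)

lemma app_smul_of_fderiv {d m : ℕ} (f : NCSelfMap d) (hf0 : f.app 1 0 = 0) {W : MatTuple d m}
    (hW : rowGram W = 1) (h : fderiv ℂ (f.app m) 0 W = W) {t : ℂ} (ht : ‖t‖ < 1) :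
    f.app m (t • W) = t • W := by
  refine f.app_smul_of_dslope hf0 hW (z := 0) (by simp) ?_ ht
  rw [dslope_same, (f.hasDerivAt_smul W).deriv, h]

end NCSelfMap

/-- The spectral theorem as a factorization. -/
lemma Matrix.IsHermitian.exists_unitary_diagonal {n : ℕ} {M : Matrix (Fin n) (Fin n) ℂ}
    (hM : M.IsHermitian) : ∃ (U : Matrix (Fin n) (Fin n) ℂ) (μ : Fin n → ℝ),
      U * Uᴴ = 1 ∧ Uᴴ * U = 1 ∧ M = U * Matrix.diagonal (fun i => (μ i : ℂ)) * Uᴴ := by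
  refine ⟨hM.eigenvectorUnitary, hM.eigenvalues, ?_, ?_, ?_⟩
  · exact Unitary.coe_mul_star_self hM.eigenvectorUnitary
  · exact Unitary.coe_star_mul_self hM.eigenvectorUnitary
  · conv_lhs => rw [hM.spectral_theorem, Unitary.conjStarAlgAut_apply]
    rfl

lemma posDef_unitary_conj_diagonal_iff {n : ℕ} {U : Matrix (Fin n) (Fin n) ℂ} (hU : U * Uᴴ = 1)
    (μ : Fin n → ℝ) :
    (U * Matrix.diagonal (fun i => (μ i : ℂ)) * Uᴴ).PosDef ↔ ∀ i, 0 < μ i := by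
  have h := Matrix.IsUnit.posDef_star_right_conjugate_iff (IsUnit.of_mul_eq_one _ hU)
    (x := Matrix.diagonal (fun i => (μ i : ℂ)))
  rw [Matrix.star_eq_conjTranspose] at h
  rw [h, Matrix.posDef_diagonal_iff]
  simp

lemma norm_mobius {a : ℝ} (ha0 : 0 < a) (ha1 : a < 1) {t : ℂ} (ht : ‖t‖ ≤ 1) :
    1 + (a : ℂ) * t ≠ 0 ∧ ‖(t + a) / (1 + a * t)‖ ≤ 1 ∧
      (‖t‖ = 1 → ‖(t + a) / (1 + a * t)‖ = 1) := by
  have h0 : 1 + (a : ℂ) * t ≠ 0 := fun h => by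
    have h1 : ‖(a : ℂ) * t‖ = 1 := by rw [← neg_eq_of_add_eq_zero_right h]; simp
    rw [norm_mul, Complex.norm_real, Real.norm_of_nonneg ha0.le] at h1
    nlinarith [norm_nonneg t]
  have hid : ‖1 + (a : ℂ) * t‖ ^ 2 - ‖t + a‖ ^ 2 = (1 - a ^ 2) * (1 - ‖t‖ ^ 2) := by
    simp only [Complex.sq_norm, Complex.normSq_apply, Complex.add_re, Complex.add_im,
      Complex.mul_re, Complex.mul_im, Complex.ofReal_re, Complex.ofReal_im, Complex.one_re,
      Complex.one_im]
    ring
  have hp : 0 < ‖1 + (a : ℂ) * t‖ := norm_pos_iff.mpr h0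
  refine ⟨h0, ?_, fun h => ?_⟩
  · rw [norm_div, div_le_one hp]
    refine abs_le_of_sq_le_sq' ?_ hp.le |>.2
    have : 0 ≤ (1 - a ^ 2) * (1 - ‖t‖ ^ 2) :=
      mul_nonneg (by nlinarith) (by nlinarith [norm_nonneg t])
    linarith
  · rw [norm_div, div_eq_one_iff_eq hp.ne']
    rw [h] at hid
    exact (sq_eq_sq₀ (norm_nonneg _) hp.le).mp (by linarith)

lemma linRel_subset_mul {d n : ℕ} (Z : MatTuple d n) (G : Matrix (Fin n) (Fin n) ℂ) :
    linRel Z ⊆ linRel fun j => G * Z j := fun α hα => by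
  have h : ∑ j, α j • Z j = 0 := hα
  change ∑ j, α j • (G * Z j) = 0
  simp_rw [← Matrix.mul_smul, ← Finset.mul_sum, h, mul_zero]

namespace NCSelfMap

lemma app_eq_of_rowGram {d m : ℕ} (f : NCSelfMap d) (hf0 : f.app 1 0 = 0) {Z : MatTuple d m}
    {s : ℝ} (hs0 : 0 < s) (hs1 : s < 1) (hZ : rowGram Z = ((s ^ 2 : ℝ) : ℂ) • 1)
    (hD : fderiv ℂ (f.app m) 0 Z = Z) : f.app m Z = Z := by
  have hs : (s : ℂ) ≠ 0 := by exact_mod_cast hs0.ne'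
  have hW : rowGram ((s : ℂ)⁻¹ • Z) = 1 := by
    rw [rowGram_smul, hZ, smul_smul]
    convert one_smul ℂ _ using 2
    simp only [star_inv₀, Complex.star_def, Complex.conj_ofReal]
    push_cast
    field_simp
  have := f.app_smul_of_fderiv hf0 hW (by rw [map_smul, hD]) (t := s)
    (by rwa [Complex.norm_real, Real.norm_of_nonneg hs0.le])
  simpa [smul_smul, hs] using! this

lemma fderiv_eq_self_of_rowGram {d m : ℕ} (f : NCSelfMap d) (hf0 : f.app 1 0 = 0)
    {Z : MatTuple d m} {s : ℝ} (hs0 : 0 < s) (hs1 : s < 1)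
    (hZ : rowGram Z = ((s ^ 2 : ℝ) : ℂ) • 1) (h : f.app m Z = Z) :
    fderiv ℂ (f.app m) 0 Z = Z := by
  have hs : (s : ℂ) ≠ 0 := by exact_mod_cast hs0.ne'
  have hW : rowGram ((s : ℂ)⁻¹ • Z) = 1 := by
    rw [rowGram_smul, hZ, smul_smul]
    convert one_smul ℂ _ using 2
    simp only [star_inv₀, Complex.star_def, Complex.conj_ofReal]
    push_cast
    field_simp
  have hWZ : (s : ℂ) • ((s : ℂ)⁻¹ • Z) = Z := by
    rw [smul_smul, mul_inv_cancel₀ hs, one_smul]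
  have := f.fderiv_of_app_smul hf0 hW (z := s)
    (by rwa [Complex.norm_real, Real.norm_of_nonneg hs0.le]) hs (by rw [hWZ, h])
  rw [← hWZ, map_smul, this]

/-- If the derivative at the origin fixes all tuples satisfying the linear relations of `Z`, and
the Gram matrix of `Z` is nonsingular, then `Z` is fixed. -/
lemma app_eq_of_posDef {d m : ℕ} (f : NCSelfMap d) (hf0 : f.app 1 0 = 0) {Z : MatTuple d m}
    (hZ : Z ∈ freeBall d m) (hpos : (rowGram Z).PosDef)
    (hD : ∀ W : MatTuple d m, linRel Z ⊆ linRel W → fderiv ℂ (f.app m) 0 W = W) :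
    f.app m Z = Z := by
  obtain ⟨U, μ, hU, hU', hM⟩ := (rowGram_isHermitian Z).exists_unitary_diagonal
  have hμ0 : ∀ i, 0 < μ i := by
    rw [hM] at hpos
    exact (posDef_unitary_conj_diagonal_iff hU μ).mp hpos
  have hconj : ∀ ν : Fin m → ℝ, 1 - U * Matrix.diagonal (fun i => (ν i : ℂ)) * Uᴴ =
      U * Matrix.diagonal (fun i => ((1 - ν i : ℝ) : ℂ)) * Uᴴ := fun ν => by
    have : Matrix.diagonal (fun i => ((1 - ν i : ℝ) : ℂ)) =
        1 - Matrix.diagonal (fun i => (ν i : ℂ)) := by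
      rw [← Matrix.diagonal_one, Matrix.diagonal_sub]
      simp
    rw [this, mul_sub, sub_mul, mul_one, hU]
  have hμ1 : ∀ i, μ i < 1 := fun i => by
    have hZ' : (1 - rowGram Z).PosDef := hZ
    rw [hM, hconj, posDef_unitary_conj_diagonal_iff hU] at hZ'
    exact sub_pos.mp (hZ' i)
  obtain ⟨s, hsμ, hs0, hs1⟩ : ∃ s : ℝ, (∀ i, √(μ i) < s) ∧ 0 < s ∧ s < 1 := by
    have h1 : ∀ᶠ s : ℝ in 𝓝[<] 1, ∀ i, √(μ i) < s := Filter.eventually_all.mpr fun i =>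
      nhdsWithin_le_nhds (lt_mem_nhds ((Real.sqrt_lt' one_pos).mpr (by simpa using hμ1 i)))
    have h2 : ∀ᶠ s : ℝ in 𝓝[<] 1, 0 < s := nhdsWithin_le_nhds (lt_mem_nhds one_pos)
    exact (h1.and (h2.and self_mem_nhdsWithin)).exists
  set a : Fin m → ℝ := fun i => √(μ i) / s
  have ha0 : ∀ i, 0 < a i := fun i => div_pos (Real.sqrt_pos.mpr (hμ0 i)) hs0
  have ha1 : ∀ i, a i < 1 := fun i => (div_lt_one hs0).mpr (hsμ i)
  have haμ : ∀ i, μ i = (a i * s) ^ 2 := fun i => by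
    simp [a, div_mul_cancel₀ _ hs0.ne', Real.sq_sqrt (hμ0 i).le]
  let L : (Fin m → ℂ) →L[ℂ] MatTuple d m := LinearMap.toContinuousLinearMap
    { toFun := fun x j => U * Matrix.diagonal x * Uᴴ * Z j
      map_add' := fun x y => by
        funext j
        have : Matrix.diagonal (x + y) = Matrix.diagonal x + Matrix.diagonal y :=
          (Matrix.diagonal_add x y).symm
        change _ = U * Matrix.diagonal x * Uᴴ * Z j + U * Matrix.diagonal y * Uᴴ * Z j
        rw [this, mul_add, add_mul, add_mul]
      map_smul' := fun c x => by
        funext j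
        simp [Matrix.diagonal_smul] }
  let b : ℂ → Fin m → ℂ := fun t i => (t + a i) / (1 + a i * t) / a i
  have hL1 : ∀ x, linRel Z ⊆ linRel (L x) := fun x => linRel_subset_mul Z _
  have hgram : ∀ t, rowGram (L (b t)) = U * Matrix.diagonal
      (fun i => ((‖(t + a i) / (1 + a i * t)‖ ^ 2 * s ^ 2 : ℝ) : ℂ)) * Uᴴ := fun t => by
    change rowGram (fun j => U * Matrix.diagonal (b t) * Uᴴ * Z j) = _
    rw [rowGram_left_mul, hM]
    have h1 : Matrix.diagonal (fun i =>
        ((‖(t + a i) / (1 + a i * t)‖ ^ 2 * s ^ 2 : ℝ) : ℂ)) =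
        Matrix.diagonal (b t) * Matrix.diagonal (fun i => (μ i : ℂ)) *
          (Matrix.diagonal (b t))ᴴ := by
      rw [Matrix.diagonal_conjTranspose, Matrix.diagonal_mul_diagonal,
        Matrix.diagonal_mul_diagonal]
      congr 1
      funext i
      have h2 : (a i : ℂ) ≠ 0 := by exact_mod_cast (ha0 i).ne'
      have h3 : b t i * star (b t i) =
          ((‖(t + a i) / (1 + a i * t)‖ ^ 2 : ℝ) : ℂ) / (a i : ℂ) ^ 2 := by
        rw [Complex.star_def, Complex.mul_conj, Complex.normSq_eq_norm_sq]
        simp only [b]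
        rw [norm_div _ (a i : ℂ), Complex.norm_real, div_pow, Real.norm_eq_abs, sq_abs]
        push_cast
        rfl
      rw [Pi.star_apply, mul_right_comm, h3, haμ i]
      push_cast
      field_simp
    rw [h1]
    simp only [Matrix.conjTranspose_mul, Matrix.conjTranspose_conjTranspose, Matrix.mul_assoc]
    rw [← Matrix.mul_assoc Uᴴ U, hU', Matrix.one_mul, ← Matrix.mul_assoc Uᴴ U, hU',
      Matrix.one_mul]
  have hcl : closure (Metric.ball (0 : ℂ) 1) = Metric.closedBall 0 1 :=
    closure_ball 0 one_ne_zero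
  have hmaps : Set.MapsTo (fun t => L (b t)) (Metric.closedBall 0 1) (freeBall d m) :=
    fun t ht => by
      change (1 - rowGram (L (b t))).PosDef
      rw [hgram, hconj, posDef_unitary_conj_diagonal_iff hU]
      intro i
      have h1 := (norm_mobius (ha0 i) (ha1 i) (mem_closedBall_zero_iff.mp ht)).2.1
      have h2 : ‖(t + a i) / (1 + a i * t)‖ ^ 2 ≤ 1 := by
        nlinarith [norm_nonneg ((t + a i) / (1 + a i * t))]
      nlinarith
  have hdiff : DifferentiableOn ℂ (fun t => L (b t)) (Metric.closedBall 0 1) := by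
    refine L.differentiable.comp_differentiableOn (differentiableOn_pi.mpr fun i => ?_)
    have h1 : ∀ t ∈ Metric.closedBall (0 : ℂ) 1, 1 + (a i : ℂ) * t ≠ 0 := fun t ht =>
      (norm_mobius (ha0 i) (ha1 i) (mem_closedBall_zero_iff.mp ht)).1
    have h2 : DifferentiableOn ℂ (fun t : ℂ => (t + a i) / (1 + a i * t))
        (Metric.closedBall 0 1) := DifferentiableOn.div (by fun_prop) (by fun_prop) h1
    exact h2.div_const _
  have hfr : Set.EqOn (fun t => f.app m (L (b t))) (fun t => L (b t))
      (frontier (Metric.ball 0 1)) := fun t ht => by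
    rw [frontier_ball 0 one_ne_zero, mem_sphere_zero_iff_norm] at ht
    refine f.app_eq_of_rowGram hf0 hs0 hs1 ?_ (hD _ (hL1 _))
    have h1 : (fun i => ((‖(t + a i) / (1 + a i * t)‖ ^ 2 * s ^ 2 : ℝ) : ℂ)) =
        fun _ => ((s ^ 2 : ℝ) : ℂ) := funext fun i => by
      rw [(norm_mobius (ha0 i) (ha1 i) ht.le).2.2 ht, one_pow, one_mul]
    rw [hgram, h1, ← Matrix.smul_one_eq_diagonal, Matrix.mul_smul, Matrix.smul_mul, mul_one, hU]
  have hE := Complex.eqOn_of_eqOn_frontier Metric.isBounded_ball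
    (DifferentiableOn.diffContOnCl (by rw [hcl]; exact (f.holo m).comp hdiff hmaps))
    (DifferentiableOn.diffContOnCl (by rw [hcl]; exact hdiff)) hfr
    (Metric.mem_ball_self one_pos)
  have hb0 : L (b 0) = Z := by
    have : b 0 = fun _ => 1 := funext fun i => by
      have h2 : (a i : ℂ) ≠ 0 := by exact_mod_cast (ha0 i).ne'
      simp [b, h2]
    funext j
    change U * Matrix.diagonal (b 0) * Uᴴ * Z j = Z j
    rw [this, Matrix.diagonal_one, mul_one, hU, one_mul]
  simpa only [hb0] using hE

lemma app_eq_of_linRel {d n m : ℕ} (f : NCSelfMap d) (hf0 : f.app 1 0 = 0) {Y : MatTuple d n}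
    (hY : fderiv ℂ (f.app n) 0 Y = Y) {Z : MatTuple d m} (hZ : Z ∈ freeBall d m)
    (hYZ : linRel Y ⊆ linRel Z) : f.app m Z = Z := by
  by_cases hY0 : Y = 0
  · have hZ0 : Z = 0 := funext fun j => by
      have : Pi.single j (1 : ℂ) ∈ linRel Z := hYZ (by simp [hY0, linRel])
      simpa [linRel, Pi.single_apply] using this
    rw [hZ0, f.app_zero hf0]
  obtain ⟨i, p, q, hpq⟩ : ∃ i p q, Y i p q ≠ 0 := by
    by_contra! h
    exact hY0 (funext fun i => Matrix.ext (h i))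
  set y : Fin d → ℂ := fun j => Y j p q
  have hcont : Continuous fun t : ℂ => Z + t • scalarPt d m y := by fun_prop
  have hlin : ∀ t : ℂ, linRel Y ⊆ linRel (Z + t • scalarPt d m y) := fun t α hα => by
    have h1 : ∑ j, α j • Y j = 0 := hα
    have h2 : ∑ j, α j • Z j = 0 := hYZ hα
    have h3 : ∑ j, α j * y j = 0 := by
      simpa [Matrix.sum_apply] using congrFun (congrFun h1 p) q
    change ∑ j, α j • (Z j + t • y j • 1) = 0
    simp_rw [smul_add, Finset.sum_add_distrib, h2, zero_add, smul_comm _ t, smul_smul _ (y _),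
      ← Finset.smul_sum, ← Finset.sum_smul, h3, zero_smul, smul_zero]
  have hnhds : freeBall d m ∈ 𝓝 Z := (isOpen_freeBall d m).mem_nhds hZ
  have hmem : ∀ᶠ t in 𝓝[≠] (0 : ℂ), Z + t • scalarPt d m y ∈ freeBall d m :=
    nhdsWithin_le_nhds (hcont.continuousAt.eventually_mem (by simpa using hnhds))
  have hdet : ∀ᶠ t in 𝓝[≠] (0 : ℂ), IsUnit (Z i + (t * y i) • (1 : Matrix (Fin m) (Fin m) ℂ)) := by
    have hfin : {t : ℂ | (-Z i).charpoly.IsRoot (t * y i)}.Finite := by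
      have := Polynomial.finite_setOfPred_isRoot (Matrix.charpoly_monic (-Z i)).ne_zero
      exact this.preimage ((mul_left_injective₀ hpq).injOn)
    have h1 : ∀ᶠ t in 𝓝[≠] (0 : ℂ), ¬ (-Z i).charpoly.IsRoot (t * y i) :=
      nhdsNE_le_cofinite _ hfin.compl_mem_cofinite
    filter_upwards [h1] with t ht
    rw [Matrix.isUnit_iff_isUnit_det, isUnit_iff_ne_zero]
    intro h
    apply ht
    rw [Polynomial.IsRoot, Matrix.eval_charpoly, ← h, sub_neg_eq_add, add_comm,
      Matrix.smul_one_eq_diagonal]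
    rfl
  have hev : ∀ᶠ t in 𝓝[≠] (0 : ℂ),
      f.app m (Z + t • scalarPt d m y) = Z + t • scalarPt d m y := by
    filter_upwards [hmem, hdet] with t ht hu
    refine f.app_eq_of_posDef hf0 ht ?_ fun W hW =>
      f.fderiv_eq_self_of_linRel hY ((hlin t).trans hW)
    rw [rowGram, ← Finset.add_sum_erase _ _ (Finset.mem_univ i)]
    refine Matrix.PosDef.add_posSemidef ?_ (Matrix.posSemidef_sum _ fun j _ =>
      Matrix.posSemidef_self_mul_conjTranspose _)
    have : (Z + t • scalarPt d m y) i = Z i + (t * y i) • 1 := by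
      simp [scalarPt, smul_smul]
    rw [this]
    exact Matrix.PosDef.mul_conjTranspose_self _ (Matrix.vecMul_injective_of_isUnit hu)
  have hfc : ContinuousAt (f.app m) (Z + (0 : ℂ) • scalarPt d m y) := by
    simpa using (f.holo m).continuousOn.continuousAt hnhds
  have hl := (ContinuousAt.comp (f := fun t : ℂ => Z + t • scalarPt d m y) hfc
    hcont.continuousAt).tendsto.mono_left (nhdsWithin_le_nhds (s := {0}ᶜ))
  have hr := (hcont.tendsto 0).mono_left (nhdsWithin_le_nhds (s := {0}ᶜ))
  simpa using tendsto_nhds_unique_of_eventuallyEq hl hr hev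

end NCSelfMap

/-- The completely positive map `T ↦ ∑ j, X j * T * (X j)ᴴ`. -/
def cpMap {d n : ℕ} (X : MatTuple d n) :
    Matrix (Fin n) (Fin n) ℂ →ₗ[ℝ] Matrix (Fin n) (Fin n) ℂ where
  toFun T := ∑ j, X j * T * (X j)ᴴ
  map_add' S T := by simp [mul_add, add_mul, Finset.sum_add_distrib]
  map_smul' c T := by simp [Finset.smul_sum]

lemma cpMap_apply {d n : ℕ} (X : MatTuple d n) (T : Matrix (Fin n) (Fin n) ℂ) :
    cpMap X T = ∑ j, X j * T * (X j)ᴴ := rfl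

lemma cpMap_posSemidef {d n : ℕ} (X : MatTuple d n) {T : Matrix (Fin n) (Fin n) ℂ}
    (hT : T.PosSemidef) : (cpMap X T).PosSemidef :=
  Matrix.posSemidef_sum _ fun j _ => hT.mul_mul_conjTranspose_same (X j)

lemma continuous_cpMap {d n : ℕ} (X : MatTuple d n) : Continuous (cpMap X) := by
  change Continuous fun T => ∑ j, X j * T * (X j)ᴴ
  fun_prop

/-- For a generic tuple, a nonzero positive semidefinite matrix whose kernel is invariant under
the adjoint tuple is positive definite. -/
lemma IsGeneric.posDef_of_ker {d n : ℕ} {X : MatTuple d n} (hX : IsGeneric X)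
    {M : Matrix (Fin n) (Fin n) ℂ} (hM : M.PosSemidef) (hM0 : M ≠ 0)
    (h : ∀ v, M *ᵥ v = 0 → star v ⬝ᵥ cpMap X M *ᵥ v = 0) : M.PosDef := by
  have hker : ∀ v, M *ᵥ v = 0 → ∀ j, M *ᵥ ((X j)ᴴ *ᵥ v) = 0 := fun v hv j => by
    have h1 := h v hv
    rw [cpMap_apply, Matrix.sum_mulVec, dotProduct_sum,
      Finset.sum_eq_zero_iff_of_nonneg fun j _ =>
        (hM.mul_mul_conjTranspose_same (X j)).dotProduct_mulVec_nonneg v] at h1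
    have h2 := h1 j (Finset.mem_univ j)
    rw [← hM.dotProduct_mulVec_zero_iff, ← h2, Matrix.star_mulVec,
      Matrix.conjTranspose_conjTranspose, ← Matrix.mulVec_mulVec, ← Matrix.mulVec_mulVec,
      Matrix.dotProduct_mulVec]
    simp only [Matrix.dotProduct_mulVec]
  let A : Subalgebra ℂ (Matrix (Fin n) (Fin n) ℂ) :=
    { carrier := {a | ∀ v, M *ᵥ v = 0 → M *ᵥ (aᴴ *ᵥ v) = 0}
      mul_mem' := fun {a b} ha hb v hv => by
        rw [Matrix.conjTranspose_mul, ← Matrix.mulVec_mulVec]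
        exact hb _ (ha v hv)
      add_mem' := fun {a b} ha hb v hv => by
        rw [Matrix.conjTranspose_add, Matrix.add_mulVec, Matrix.mulVec_add, ha v hv, hb v hv,
          add_zero]
      algebraMap_mem' := fun c v hv => by
        rw [Algebra.algebraMap_eq_smul_one, Matrix.conjTranspose_smul, Matrix.conjTranspose_one,
          Matrix.smul_mulVec, Matrix.one_mulVec, Matrix.mulVec_smul, hv, smul_zero] }
  have hA : A = ⊤ := by
    rw [eq_top_iff, ← hX]
    refine Algebra.adjoin_le ?_
    rintro _ ⟨j, rfl⟩ v hv
    exact hker v hv j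
  refine .of_dotProduct_mulVec_pos hM.isHermitian fun v hv => ?_
  refine (hM.dotProduct_mulVec_nonneg v).lt_of_ne fun h0 => hM0 ?_
  have hv0 : M *ᵥ v = 0 := (hM.dotProduct_mulVec_zero_iff v).mp h0.symm
  obtain ⟨k, hk⟩ := Function.ne_iff.mp hv
  ext p q
  have ha : Matrix.single k q (star (v k)⁻¹) ∈ A := hA ▸ Algebra.mem_top
  have := congrFun (ha v hv0) p
  have h1 : (Matrix.single q k (v k)⁻¹) *ᵥ v = Pi.single q 1 := by
    rw [Matrix.single_mulVec, inv_mul_cancel₀ hk]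
    rfl
  rw [Matrix.conjTranspose_single, star_star, h1, Matrix.mulVec_single_one] at this
  exact this

lemma isClosed_posSemidef (n : ℕ) :
    IsClosed {T : Matrix (Fin n) (Fin n) ℂ | T.PosSemidef} := by
  simp only [Matrix.posSemidef_iff_dotProduct_mulVec, Matrix.IsHermitian, Set.ofPred_and,
    Set.ofPred_forall]
  refine (isClosed_eq (by fun_prop) (by fun_prop)).inter (isClosed_iInter fun v => ?_)
  exact isClosed_le continuous_const (by fun_prop)

lemma Matrix.PosSemidef.eq_zero_of_add {n : ℕ} {S T : Matrix (Fin n) (Fin n) ℂ}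
    (hS : S.PosSemidef) (hT : T.PosSemidef) (h : S + T = 0) : S = 0 := by
  have h1 := hS.trace_nonneg
  have h2 := hT.trace_nonneg
  have h3 : S.trace + T.trace = 0 := by rw [← Matrix.trace_add, h, Matrix.trace_zero]
  exact hS.trace_eq_zero_iff.mp ((add_eq_zero_iff_of_nonneg h1 h2).mp h3).1

/-- The Collatz–Wielandt maximum is attained. -/
lemma exists_max_collatzWielandt {d n : ℕ} (hn : n ≠ 0) (X : MatTuple d n) :
    ∃ (r : ℝ) (T : Matrix (Fin n) (Fin n) ℂ), T.PosSemidef ∧ T ≠ 0 ∧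
      (cpMap X T - r • T).PosSemidef ∧ ∀ (r' : ℝ) (T' : Matrix (Fin n) (Fin n) ℂ),
        T'.PosSemidef → T' ≠ 0 → (cpMap X T' - r' • T').PosSemidef → r' ≤ r := by
  have hcp := continuous_cpMap X
  set K : Set (Matrix (Fin n) (Fin n) ℂ) := Metric.sphere 0 1 ∩ {T | T.PosSemidef}
  have hK : IsCompact K := (isCompact_sphere _ _).inter_right (isClosed_posSemidef n)
  have htr : ∀ T ∈ K, 0 < T.trace.re := fun T hT => by
    have h1 := hT.2.trace_nonneg
    have h2 : T.trace ≠ 0 := fun h =>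
      ne_zero_of_mem_unit_sphere ⟨T, hT.1⟩ (hT.2.trace_eq_zero_iff.mp h)
    exact (Complex.pos_iff.mp (h1.lt_of_ne h2.symm)).1
  obtain ⟨R, hR⟩ : BddAbove ((fun T => (cpMap X T).trace.re / T.trace.re) '' K) :=
    hK.bddAbove_image (ContinuousOn.div (by fun_prop) (by fun_prop) fun T hT => (htr T hT).ne')
  have hRb : ∀ (r : ℝ), ∀ T ∈ K, (cpMap X T - r • T).PosSemidef → r ≤ R := fun r T hT h => by
    refine le_trans ?_ (hR (Set.mem_image_of_mem _ hT))
    rw [le_div_iff₀ (htr T hT)]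
    have := (Complex.le_def.mp h.trace_nonneg).1
    simpa [Matrix.trace_sub, Matrix.trace_smul] using this
  set Q : Set (ℝ × Matrix (Fin n) (Fin n) ℂ) :=
    (Set.Icc 0 R ×ˢ K) ∩ {p | (cpMap X p.2 - p.1 • p.2).PosSemidef}
  have hQ : IsCompact Q := (isCompact_Icc.prod hK).inter_right
    ((isClosed_posSemidef n).preimage (by fun_prop))
  have hnorm : ∀ T : Matrix (Fin n) (Fin n) ℂ, T.PosSemidef → T ≠ 0 → ‖T‖⁻¹ • T ∈ K :=
    fun T hT hT0 => by
      have : ‖T‖ ≠ 0 := norm_ne_zero_iff.mpr hT0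
      exact ⟨by simp [norm_smul, this], hT.smul (by positivity)⟩
  have hscale : ∀ (r : ℝ) (T : Matrix (Fin n) (Fin n) ℂ), (cpMap X T - r • T).PosSemidef →
      (cpMap X (‖T‖⁻¹ • T) - r • ‖T‖⁻¹ • T).PosSemidef := fun r T h => by
    rw [map_smul, smul_comm, ← smul_sub]
    exact h.smul (by positivity)
  have hmem : ∀ (r : ℝ) (T : Matrix (Fin n) (Fin n) ℂ), 0 ≤ r → T.PosSemidef → T ≠ 0 →
      (cpMap X T - r • T).PosSemidef → (r, ‖T‖⁻¹ • T) ∈ Q := fun r T hr hT hT0 h =>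
    ⟨⟨⟨hr, hRb r _ (hnorm T hT hT0) (hscale r T h)⟩, hnorm T hT hT0⟩, hscale r T h⟩
  have : Nonempty (Fin n) := ⟨⟨0, Nat.pos_of_ne_zero hn⟩⟩
  have hne : Q.Nonempty := ⟨_, hmem 0 1 le_rfl .one one_ne_zero
    (by simpa using cpMap_posSemidef X .one)⟩
  obtain ⟨⟨r, T⟩, ⟨⟨hr, hT⟩, hTr⟩, hmax⟩ := hQ.exists_isMaxOn hne continuous_fst.continuousOn
  refine ⟨r, T, hT.2, ne_zero_of_mem_unit_sphere ⟨T, hT.1⟩, hTr, fun r' T' hT' hT0' h => ?_⟩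
  by_cases hr' : 0 ≤ r'
  · exact hmax (hmem r' T' hr' hT' hT0' h)
  · exact (not_le.mp hr').le.trans hr.1

/-- Perron–Frobenius for the completely positive map of a generic tuple. -/
lemma IsGeneric.exists_posDef_eigenvector {d n : ℕ} (hn : n ≠ 0) {X : MatTuple d n}
    (hX : IsGeneric X) :
    ∃ (r : ℝ) (T : Matrix (Fin n) (Fin n) ℂ), T.PosDef ∧ cpMap X T = r • T := by
  obtain ⟨r, T, hT, hT0, hB, hmax⟩ := exists_max_collatzWielandt hn X
  have hnotPos : ∀ T : Matrix (Fin n) (Fin n) ℂ, T.PosSemidef → T ≠ 0 →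
      ¬ (cpMap X T - r • T).PosDef := fun T hT hT0 h => by
    have hev : ∀ᶠ s in 𝓝[>] r, (cpMap X T - s • T).PosDef := nhdsWithin_le_nhds <|
      eventually_posDef (M := fun s : ℝ => cpMap X T - s • T) (by fun_prop) (fun s =>
        (cpMap_posSemidef X hT).isHermitian.sub
          (by simp [Matrix.IsHermitian, Matrix.conjTranspose_smul, hT.isHermitian.eq])) h
    obtain ⟨s, hs, hrs⟩ := (hev.and self_mem_nhdsWithin).exists
    exact absurd (hmax s T hT hT0 hs.posSemidef) (not_le.mpr hrs)
  have hzero : ∀ (k : ℕ) (T : Matrix (Fin n) (Fin n) ℂ), T.PosSemidef → T ≠ 0 →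
      (cpMap X T - r • T).PosSemidef →
      Module.finrank ℂ (LinearMap.ker (cpMap X T - r • T).mulVecLin) = k →
      cpMap X T - r • T = 0 := by
    intro k
    induction k using Nat.strong_induction_on with
    | _ k ih =>
      intro T hT hT0 hB hk
      by_contra hB0
      set B := cpMap X T - r • T
      have hcB := cpMap_posSemidef X hB
      have hB' : cpMap X (T + cpMap X T) - r • (T + cpMap X T) = B + cpMap X B := by
        simp only [B, map_add, map_sub, map_smul, smul_add]
        abel
      have hT' : T + cpMap X T ≠ 0 := fun h =>
        hT0 (hT.eq_zero_of_add (cpMap_posSemidef X hT) h)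
      have hzero_iff : ∀ v, (B + cpMap X B) *ᵥ v = 0 →
          B *ᵥ v = 0 ∧ star v ⬝ᵥ cpMap X B *ᵥ v = 0 := fun v hv => by
        have h1 : star v ⬝ᵥ B *ᵥ v + star v ⬝ᵥ cpMap X B *ᵥ v = 0 := by
          rw [← dotProduct_add, ← Matrix.add_mulVec, hv, dotProduct_zero]
        have h2 := (add_eq_zero_iff_of_nonneg (hB.dotProduct_mulVec_nonneg v)
          (hcB.dotProduct_mulVec_nonneg v)).mp h1
        exact ⟨(hB.dotProduct_mulVec_zero_iff v).mp h2.1, h2.2⟩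
      have hle : LinearMap.ker (B + cpMap X B).mulVecLin ≤ LinearMap.ker B.mulVecLin :=
        fun v hv => (hzero_iff v hv).1
      have hne : LinearMap.ker (B + cpMap X B).mulVecLin ≠ LinearMap.ker B.mulVecLin :=
        fun heq => hnotPos T hT hT0 <| hX.posDef_of_ker hB hB0 fun v hv =>
          (hzero_iff v (heq.ge hv)).2
      have hlt := Submodule.finrank_lt_finrank_of_lt (lt_of_le_of_ne hle hne)
      have h0 := ih _ (hk ▸ hlt) (T + cpMap X T) (hT.add (cpMap_posSemidef X hT)) hT'
        (by rw [hB']; exact hB.add hcB) (by rw [hB'])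
      rw [hB'] at h0
      exact hB0 (hB.eq_zero_of_add hcB h0)
  have hTr : cpMap X T = r • T := sub_eq_zero.mp (hzero _ T hT hT0 hB rfl)
  refine ⟨r, T, hX.posDef_of_ker hT hT0 fun v hv => ?_, hTr⟩
  rw [hTr, Matrix.smul_mulVec, hv, smul_zero, dotProduct_zero]

/-- A generic point of the free ball is similar to a multiple of a row coisometry. -/
lemma IsGeneric.exists_similar {d n : ℕ} (hn : n ≠ 0) {X : MatTuple d n} (hX : X ∈ freeBall d n)
    (hgen : IsGeneric X) : ∃ (r : ℝ) (C : Matrix (Fin n) (Fin n) ℂ), r < 1 ∧ IsUnit C.det ∧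
      rowGram (fun j => C⁻¹ * X j * C) = (r : ℂ) • 1 := by
  obtain ⟨r, T, hT, hTr⟩ := hgen.exists_posDef_eigenvector hn
  obtain ⟨U, μ, hU, hU', hTU⟩ := hT.isHermitian.exists_unitary_diagonal
  have hμ : ∀ i, 0 < μ i := by
    rw [hTU] at hT
    exact (posDef_unitary_conj_diagonal_iff hU μ).mp hT
  set C := U * Matrix.diagonal fun i => ((√(μ i) : ℝ) : ℂ)
  have hC : C * Cᴴ = T := by
    rw [hTU, Matrix.conjTranspose_mul, Matrix.diagonal_conjTranspose, Matrix.mul_assoc,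
      ← Matrix.mul_assoc (Matrix.diagonal _), Matrix.diagonal_mul_diagonal, Matrix.mul_assoc]
    congr 3
    ext i
    simp only [Pi.star_apply, Complex.star_def, Complex.conj_ofReal]
    rw [← Complex.ofReal_mul, Real.mul_self_sqrt (hμ i).le]
  have hCu : IsUnit C.det := by
    have := (Matrix.isUnit_iff_isUnit_det T).mp hT.isUnit
    rw [← hC, Matrix.det_mul] at this
    exact isUnit_of_mul_isUnit_left this
  have hCh : IsUnit (Cᴴ).det := by rw [Matrix.det_conjTranspose]; exact hCu.star
  refine ⟨r, C, ?_, hCu, ?_⟩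
  · have : Nonempty (Fin n) := ⟨⟨0, Nat.pos_of_ne_zero hn⟩⟩
    obtain ⟨i, hi⟩ := Finite.exists_max μ
    set v := U *ᵥ Pi.single i 1
    have hv : v ≠ 0 := fun h => by
      have : Uᴴ *ᵥ v = Pi.single i 1 := by rw [Matrix.mulVec_mulVec, hU', Matrix.one_mulVec]
      rw [h, Matrix.mulVec_zero] at this
      simpa using congrFun this i
    have hTv : T *ᵥ v = (μ i : ℂ) • v := by
      simp only [v]
      rw [hTU, Matrix.mulVec_mulVec, Matrix.mul_assoc, hU', Matrix.mul_one,
        ← Matrix.mulVec_mulVec, Matrix.diagonal_mulVec_single, ← Matrix.mulVec_smul,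
        ← Pi.single_smul, smul_eq_mul]
    have hdiff : (μ i • (1 : Matrix (Fin n) (Fin n) ℂ) - T).PosSemidef := by
      have : μ i • (1 : Matrix (Fin n) (Fin n) ℂ) - T =
          U * Matrix.diagonal (fun k => ((μ i - μ k : ℝ) : ℂ)) * Uᴴ := by
        have h1 : Matrix.diagonal (fun k => ((μ i - μ k : ℝ) : ℂ)) =
            μ i • (1 : Matrix (Fin n) (Fin n) ℂ) - Matrix.diagonal fun k => (μ k : ℂ) := by
          ext a b
          by_cases hab : a = b <;> simp [hab]
        rw [h1, hTU, mul_sub, sub_mul, Matrix.mul_smul, Matrix.mul_one, Matrix.smul_mul, hU]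
      rw [this]
      refine Matrix.PosSemidef.mul_mul_conjTranspose_same (Matrix.PosSemidef.diagonal fun k => ?_) U
      simpa using hi k
    have hone : cpMap X 1 = rowGram X := by simp [cpMap_apply, rowGram]
    have h1 := (Complex.le_def.mp ((cpMap_posSemidef X hdiff).dotProduct_mulVec_nonneg v)).1
    rw [map_sub, map_smul, hone, hTr, Matrix.sub_mulVec, Matrix.smul_mulVec, Matrix.smul_mulVec,
      hTv, dotProduct_sub, dotProduct_smul, dotProduct_smul, dotProduct_smul] at h1
    have h2 := Matrix.PosDef.re_dotProduct_pos hX hv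
    have h3 := (Matrix.PosDef.one (n := Fin n) (R := ℂ)).re_dotProduct_pos hv
    change 0 < (star v ⬝ᵥ (1 - rowGram X) *ᵥ v).re at h2
    change 0 < (star v ⬝ᵥ (1 : Matrix (Fin n) (Fin n) ℂ) *ᵥ v).re at h3
    rw [Matrix.sub_mulVec, dotProduct_sub, Matrix.one_mulVec, Complex.sub_re] at h2
    rw [Matrix.one_mulVec] at h3
    simp only [Complex.zero_re, Complex.sub_re, Complex.smul_re, smul_eq_mul,
      Complex.re_ofReal_mul] at h1
    have h4 : r * (star v ⬝ᵥ v).re ≤ (star v ⬝ᵥ rowGram X *ᵥ v).re := by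
      have := hμ i
      nlinarith
    nlinarith
  · have h1 : rowGram (fun j => C⁻¹ * X j * C) = C⁻¹ * cpMap X T * (C⁻¹)ᴴ := by
      simp only [rowGram, cpMap_apply, ← hC, Matrix.conjTranspose_mul, Finset.mul_sum,
        Finset.sum_mul, Matrix.mul_assoc]
    rw [h1, hTr, ← hC, Matrix.mul_smul, Matrix.smul_mul, ← Matrix.mul_assoc,
      Matrix.nonsing_inv_mul _ hCu, Matrix.one_mul, Matrix.conjTranspose_nonsing_inv,
      Matrix.mul_nonsing_inv _ hCh]
    ext a b
    simp

lemma IsGeneric.exists_fderiv_eq {d n : ℕ} (f : NCSelfMap d) (hf0 : f.app 1 0 = 0)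
    {X : MatTuple d n} (hX : X ∈ freeBall d n) (hgen : IsGeneric X) (hfix : f.app n X = X) :
    ∃ Y : MatTuple d n, linRel Y ⊆ linRel X ∧ fderiv ℂ (f.app n) 0 Y = Y := by
  by_cases hn : n = 0
  · subst hn
    exact ⟨X, subset_rfl, Subsingleton.elim _ _⟩
  obtain ⟨r, C, hr, hC, hgram⟩ := hgen.exists_similar hn hX
  set Y : MatTuple d n := fun j => C⁻¹ * X j * C
  have hXC : ∀ j, X j * C = C * Y j := fun j => by
    change X j * C = C * (C⁻¹ * X j * C)
    rw [Matrix.mul_assoc C⁻¹, Matrix.mul_nonsing_inv_cancel_left _ _ hC]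
  have hXY : ∀ j, C * Y j * C⁻¹ = X j := fun j => by
    rw [← hXC, Matrix.mul_nonsing_inv_cancel_right _ _ hC]
  refine ⟨Y, fun α hα => ?_, ?_⟩
  · have h : ∑ j, α j • Y j = 0 := hα
    change ∑ j, α j • X j = 0
    have hα' : ∀ j, α j • X j = C * (α j • Y j) * C⁻¹ := fun j => by
      rw [Matrix.mul_smul, Matrix.smul_mul, hXY]
    rw [Finset.sum_congr rfl fun j _ => hα' j, ← Finset.sum_mul, ← Finset.mul_sum, h, mul_zero,
      zero_mul]
  have hsq : ‖toHS d n Y‖ ^ 2 = n * r := by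
    rw [norm_toHS_sq, hgram, Matrix.trace_smul, Matrix.trace_one]
    simp [mul_comm]
  rcases le_or_gt r 0 with hr0 | hr0
  · have h1 : toHS d n Y = 0 := by
      have : ‖toHS d n Y‖ ^ 2 ≤ 0 :=
        hsq.trans_le (mul_nonpos_of_nonneg_of_nonpos n.cast_nonneg hr0)
      simpa using le_antisymm this (sq_nonneg _)
    have h2 : Y = 0 := toHS_injective d n (by rw [h1, map_zero])
    rw [h2, map_zero]
  have hfY : f.app n Y = Y := funext fun j => by
    have h := f.intertwine hX (mem_freeBall_of_rowGram_eq hr hgram) C hXC j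
    rw [hfix, hXC] at h
    have := congrArg (C⁻¹ * ·) h
    simpa only [Matrix.nonsing_inv_mul_cancel_left _ _ hC] using this.symm
  exact f.fderiv_eq_self_of_rowGram hf0 (Real.sqrt_pos.mpr hr0)
    ((Real.sqrt_lt' one_pos).mpr (by simpa using hr)) (by rw [Real.sq_sqrt hr0.le, hgram]) hfY

/-- if an nc self-map fixing the origin fixes a generic point `X`, then it
fixes every point `Z` (on every level) with `L_X ⊆ L_Z`. -/
theorem stmt_6 {d n : ℕ} (f : NCSelfMap d) (hf0 : f.app 1 0 = 0)
    (X : MatTuple d n) (hX : X ∈ freeBall d n) (hgen : IsGeneric X)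
    (hfix : f.app n X = X) :
    ∀ m : ℕ, 1 ≤ m → ∀ Z ∈ freeBall d m, linRel X ⊆ linRel Z → f.app m Z = Z := by
  intro m _ Z hZ hXZ
  obtain ⟨Y, hYX, hY⟩ := hgen.exists_fderiv_eq f hf0 hX hfix
  exact f.app_eq_of_linRel hf0 hY hZ (hYX.trans hXZ)
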